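/- Let φ ∈ J_{k,2}(O_K) with theta components h_{a,b} (a,b ∈ ℤ/4ℤ). Then the classical Jacobi form π_1 φ ∈ J_{k,2} has theta decomposition (π_1 φ)(τ,z) = Σ_{μ ∈ ℤ/4ℤ} H_μ(τ) θ_{2,μ}(τ,z), where H_μ = Σ_{b ∈ ℤ/4ℤ} h_{μ,b} a_b and H_μ = (-1)^k H_{-μ}. In particular, for each s = (a+ib)/2 ∈ O_K^♯ one has the identity θ^H_{2,s}(τ,z,z) = θ_{2,a}(τ,z) · a_b. -/

import Mathlib

noncomputable section

open Complex

/-- `τ` lies in the upper half plane. -/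
def UHP (τ : ℂ) : Prop := 0 < τ.im

/-- `eC w = exp(2 π i w)`. -/
def eC (w : ℂ) : ℂ := Complex.exp (2 * (Real.pi : ℂ) * Complex.I * w)

/-- Entries of a matrix in `SL(2, ℤ)`, as complex numbers. -/
def Ma (M : Matrix.SpecialLinearGroup (Fin 2) ℤ) : ℂ := ((M.1 0 0 : ℤ) : ℂ)
def Mb (M : Matrix.SpecialLinearGroup (Fin 2) ℤ) : ℂ := ((M.1 0 1 : ℤ) : ℂ)
def Mc (M : Matrix.SpecialLinearGroup (Fin 2) ℤ) : ℂ := ((M.1 1 0 : ℤ) : ℂ)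
def Md (M : Matrix.SpecialLinearGroup (Fin 2) ℤ) : ℂ := ((M.1 1 1 : ℤ) : ℂ)

/-- Hermitian Jacobi form of weight `k` and index `m` for the Hermitian Jacobi group over
`ℤ[i]`.  A form is a function `φ : ℂ → ℂ → ℂ → ℂ`, all conditions being imposed for `τ`
in the upper half plane.  Units `ε ∈ ℤ[i]ˣ = {1, -1, i, -i}`, and the elliptic variables
`λ = p + q i`, `μ = u + v i` range over `ℤ[i]`.  The Fourier expansion is indexed by
`n ∈ ℕ` and `r = (a + b i)/2 ∈ O_K^♯ = (i/2)ℤ[i]`, supported on `N(r) ≤ n m`,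
i.e. `a² + b² ≤ 4 n m`. -/
structure IsHJF (k m : ℕ) (φ : ℂ → ℂ → ℂ → ℂ) : Prop where
  holo : DifferentiableOn ℂ (fun p : ℂ × ℂ × ℂ => φ p.1 p.2.1 p.2.2) {p | UHP p.1}
  transf : ∀ ε : ℂ, ε ∈ ({1, -1, Complex.I, -Complex.I} : Set ℂ) →
    ∀ M : Matrix.SpecialLinearGroup (Fin 2) ℤ, ∀ τ z₁ z₂ : ℂ, UHP τ →
      φ ((Ma M * τ + Mb M) / (Mc M * τ + Md M))
        (ε * z₁ / (Mc M * τ + Md M))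
        ((starRingEnd ℂ) ε * z₂ / (Mc M * τ + Md M))
      = ε ^ k * (Mc M * τ + Md M) ^ k *
          eC ((m : ℂ) * Mc M * z₁ * z₂ / (Mc M * τ + Md M)) * φ τ z₁ z₂
  ellip : ∀ p q u v : ℤ, ∀ τ z₁ z₂ : ℂ, UHP τ →
      φ τ (z₁ + ((p : ℂ) + (q : ℂ) * Complex.I) * τ + ((u : ℂ) + (v : ℂ) * Complex.I))
          (z₂ + ((p : ℂ) - (q : ℂ) * Complex.I) * τ + ((u : ℂ) - (v : ℂ) * Complex.I))
      = eC (-(m : ℂ) * (((p : ℂ) ^ 2 + (q : ℂ) ^ 2) * τ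
          + ((p : ℂ) - (q : ℂ) * Complex.I) * z₁
          + ((p : ℂ) + (q : ℂ) * Complex.I) * z₂)) * φ τ z₁ z₂
  fourier : ∃ c : ℕ → ℤ → ℤ → ℂ,
      (∀ (n : ℕ) (a b : ℤ), 4 * (n : ℤ) * m < a ^ 2 + b ^ 2 → c n a b = 0) ∧
      ∀ τ z₁ z₂ : ℂ, UHP τ →
        HasSum (fun p : ℕ × ℤ × ℤ => c p.1 p.2.1 p.2.2 *
          eC ((p.1 : ℂ) * τ + (((p.2.1 : ℂ) + (p.2.2 : ℂ) * Complex.I) / 2) * z₁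
            + (((p.2.1 : ℂ) - (p.2.2 : ℂ) * Complex.I) / 2) * z₂)) (φ τ z₁ z₂)

/-- Classical Jacobi form of weight `k` and index `m` for `SL(2,ℤ) ⋉ ℤ²`. -/
structure IsJF (k m : ℕ) (φ : ℂ → ℂ → ℂ) : Prop where
  holo : DifferentiableOn ℂ (fun p : ℂ × ℂ => φ p.1 p.2) {p | UHP p.1}
  transf : ∀ M : Matrix.SpecialLinearGroup (Fin 2) ℤ, ∀ τ z : ℂ, UHP τ →
      φ ((Ma M * τ + Mb M) / (Mc M * τ + Md M)) (z / (Mc M * τ + Md M))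
      = (Mc M * τ + Md M) ^ k *
          eC ((m : ℂ) * Mc M * z ^ 2 / (Mc M * τ + Md M)) * φ τ z
  ellip : ∀ p q : ℤ, ∀ τ z : ℂ, UHP τ →
      φ τ (z + (p : ℂ) * τ + (q : ℂ))
      = eC (-(m : ℂ) * ((p : ℂ) ^ 2 * τ + 2 * (p : ℂ) * z)) * φ τ z
  fourier : ∃ c : ℕ → ℤ → ℂ,
      (∀ (n : ℕ) (r : ℤ), 4 * (n : ℤ) * m < r ^ 2 → c n r = 0) ∧
      ∀ τ z : ℂ, UHP τ →
        HasSum (fun p : ℕ × ℤ => c p.1 p.2 * eC ((p.1 : ℂ) * τ + (p.2 : ℂ) * z)) (φ τ z)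

/-- Modular form of weight `k` for `SL(2,ℤ)`. -/
structure IsMF (k : ℕ) (f : ℂ → ℂ) : Prop where
  holo : DifferentiableOn ℂ f {τ | UHP τ}
  transf : ∀ M : Matrix.SpecialLinearGroup (Fin 2) ℤ, ∀ τ : ℂ, UHP τ →
      f ((Ma M * τ + Mb M) / (Mc M * τ + Md M)) = (Mc M * τ + Md M) ^ k * f τ
  bounded : ∃ A B : ℝ, ∀ τ : ℂ, B ≤ τ.im → ‖f τ‖ ≤ A

/-- Cusp form of weight `k` for `SL(2,ℤ)`. -/
structure IsCF (k : ℕ) (f : ℂ → ℂ) : Prop where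
  holo : DifferentiableOn ℂ f {τ | UHP τ}
  transf : ∀ M : Matrix.SpecialLinearGroup (Fin 2) ℤ, ∀ τ : ℂ, UHP τ →
      f ((Ma M * τ + Mb M) / (Mc M * τ + Md M)) = (Mc M * τ + Md M) ^ k * f τ
  decay : ∀ ε : ℝ, 0 < ε → ∃ B : ℝ, ∀ τ : ℂ, B ≤ τ.im → ‖f τ‖ ≤ ε

/-- `M_w(SL(2,ℤ), ω̄)` for the character `ω` of `SL(2,ℤ)` with `ω(T) = ω(S) = i`:
holomorphic functions on the upper half plane, bounded at infinity, with
`f|_w T = -i f` and `f|_w S = -i f`. -/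
structure IsMFOmegaBar (w : ℕ) (f : ℂ → ℂ) : Prop where
  holo : DifferentiableOn ℂ f {τ | UHP τ}
  transT : ∀ τ : ℂ, UHP τ → f (τ + 1) = -Complex.I * f τ
  transS : ∀ τ : ℂ, UHP τ → f (-1 / τ) = -Complex.I * τ ^ w * f τ
  bounded : ∃ A B : ℝ, ∀ τ : ℂ, B ≤ τ.im → ‖f τ‖ ≤ A

/-- Hermitian theta function `θ^H_{m,s}` of index `m` with characteristic
`s = (a + b i)/2 ∈ O_K^♯`; the sum is over `r = s + m (g₁ + g₂ i) ∈ s + m ℤ[i]`. -/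
def thetaH (m : ℕ) (a b : ℤ) (τ z₁ z₂ : ℂ) : ℂ :=
  ∑' g : ℤ × ℤ,
    eC ((((a : ℂ) + 2 * m * g.1) ^ 2 + ((b : ℂ) + 2 * m * g.2) ^ 2) / (4 * m) * τ
      + (((a : ℂ) + 2 * m * g.1) + ((b : ℂ) + 2 * m * g.2) * Complex.I) / 2 * z₁
      + (((a : ℂ) + 2 * m * g.1) - ((b : ℂ) + 2 * m * g.2) * Complex.I) / 2 * z₂)

/-- Classical theta function `θ_{m,μ}(τ,z) = Σ_{r ≡ μ mod 2m} e(r²τ/(4m) + r z)`. -/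
def thetaJ (m : ℕ) (μ : ℤ) (τ z : ℂ) : ℂ :=
  ∑' g : ℤ, eC (((μ : ℂ) + 2 * m * g) ^ 2 / (4 * m) * τ + ((μ : ℂ) + 2 * m * g) * z)

/-- `h` is the family of theta components of `φ` (for index `m`): the `h_{a,b}` depend
only on `(a, b) mod 2m` and `φ = Σ_{s ∈ O_K^♯ / m O_K} h_s θ^H_{m,s}`. -/
def HasThetaDecomp (m : ℕ) (φ : ℂ → ℂ → ℂ → ℂ) (h : ℤ → ℤ → ℂ → ℂ) : Prop :=
  (∀ (a b : ℤ) (τ : ℂ), h (a + 2 * m) b τ = h a b τ ∧ h a (b + 2 * m) τ = h a b τ) ∧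
  ∀ τ z₁ z₂ : ℂ, UHP τ →
    φ τ z₁ z₂ = ∑ a ∈ Finset.range (2 * m), ∑ b ∈ Finset.range (2 * m),
      h (a : ℤ) (b : ℤ) τ * thetaH m (a : ℤ) (b : ℤ) τ z₁ z₂

/-- `ϑ₀(τ) = Σ_{r ∈ ℤ} e(r² τ)`. -/
def theta0C (τ : ℂ) : ℂ := ∑' r : ℤ, eC ((r : ℂ) ^ 2 * τ)

/-- `ϑ₁(τ) = Σ_{r odd} e(r² τ / 4)`. -/
def theta1C (τ : ℂ) : ℂ := ∑' r : ℤ, eC ((2 * (r : ℂ) + 1) ^ 2 * τ / 4)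

/-- `ξ = ϑ₁ ϑ₀' − ϑ₀ ϑ₁'`. -/
def xiC (τ : ℂ) : ℂ := theta1C τ * deriv theta0C τ - theta0C τ * deriv theta1C τ

/-- Taylor coefficient `χ_{α,β}(τ)` of `φ(τ, z₁, z₂)` around `z₁ = z₂ = 0`. -/
def chiHJF (φ : ℂ → ℂ → ℂ → ℂ) (α β : ℕ) (τ : ℂ) : ℂ :=
  (1 / ((α.factorial : ℂ) * (β.factorial : ℂ))) *
    iteratedDeriv α (fun z₁ => iteratedDeriv β (fun z₂ => φ τ z₁ z₂) 0) 0

/-- `D₀ : J_{k,m} → M_k`, `ψ ↦ ψ(·, 0)`. -/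
def D0J (ψ : ℂ → ℂ → ℂ) : ℂ → ℂ := fun τ => ψ τ 0

/-- `D₂ : J_{k,m} → S_{k+2}`, `D₂ψ = (2k/(2πi)²) ψ₂ − (2m/(2πi)) ψ₀'`, where `ψ_ν` are
the Taylor coefficients of `ψ` around `z = 0`. -/
def D2J (k m : ℕ) (ψ : ℂ → ℂ → ℂ) : ℂ → ℂ := fun τ =>
  (2 * (k : ℂ) / (2 * (Real.pi : ℂ) * Complex.I) ^ 2) *
      ((1 / 2) * iteratedDeriv 2 (fun z => ψ τ z) 0)
    - (2 * (m : ℂ) / (2 * (Real.pi : ℂ) * Complex.I)) * deriv (fun t => ψ t 0) τ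

/-- Normalized Eisenstein series `E₄`. -/
def E4C (τ : ℂ) : ℂ :=
  1 + 240 * ∑' n : ℕ, ((ArithmeticFunction.sigma 3) n : ℂ) * eC ((n : ℂ) * τ)

/-- Normalized Eisenstein series `E₆`. -/
def E6C (τ : ℂ) : ℂ :=
  1 - 504 * ∑' n : ℕ, ((ArithmeticFunction.sigma 5) n : ℂ) * eC ((n : ℂ) * τ)

/-- `f` agrees on the upper half plane with a polynomial in `E₄` and `E₆²` that is
homogeneous of weight `k - v`, i.e. supported on `4a + 12b + v = k`. -/
def IsE4E6sqPoly (v k : ℕ) (f : ℂ → ℂ) : Prop :=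
  ∃ lam : ℕ × ℕ → ℂ, ∀ τ : ℂ, UHP τ →
    f τ = ∑ p ∈ (Finset.range (k + 1) ×ˢ Finset.range (k + 1)).filter
        (fun p => 4 * p.1 + 12 * p.2 + v = k),
      lam p * E4C τ ^ p.1 * E6C τ ^ (2 * p.2)

/-- The slash action `φ|_{k,m} M` of `M ∈ SL(2,ℤ)` on functions `ℂ → ℂ → ℂ → ℂ`. -/
def slashHJF (k m : ℕ) (φ : ℂ → ℂ → ℂ → ℂ) (M : Matrix.SpecialLinearGroup (Fin 2) ℤ)
    (τ z₁ z₂ : ℂ) : ℂ :=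
  ((Mc M * τ + Md M) ^ k)⁻¹ *
    eC (-(m : ℂ) * Mc M * z₁ * z₂ / (Mc M * τ + Md M)) *
    φ ((Ma M * τ + Mb M) / (Mc M * τ + Md M)) (z₁ / (Mc M * τ + Md M)) (z₂ / (Mc M * τ + Md M))

/-- Hermitian Jacobi form of weight `k` and index `m` for the congruence subgroup `Γ₀(N)`,
with at each cusp a Fourier expansion supported on `(n, r) ∈ ℚ_{≥0} × O_K^♯`
with `N(r) ≤ n m`. -/
structure IsHJFLevel (k m N : ℕ) (φ : ℂ → ℂ → ℂ → ℂ) : Prop where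
  holo : DifferentiableOn ℂ (fun p : ℂ × ℂ × ℂ => φ p.1 p.2.1 p.2.2) {p | UHP p.1}
  transf : ∀ ε : ℂ, ε ∈ ({1, -1, Complex.I, -Complex.I} : Set ℂ) →
    ∀ M : Matrix.SpecialLinearGroup (Fin 2) ℤ, (N : ℤ) ∣ M.1 1 0 →
    ∀ τ z₁ z₂ : ℂ, UHP τ →
      φ ((Ma M * τ + Mb M) / (Mc M * τ + Md M))
        (ε * z₁ / (Mc M * τ + Md M))
        ((starRingEnd ℂ) ε * z₂ / (Mc M * τ + Md M))
      = ε ^ k * (Mc M * τ + Md M) ^ k *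
          eC ((m : ℂ) * Mc M * z₁ * z₂ / (Mc M * τ + Md M)) * φ τ z₁ z₂
  ellip : ∀ p q u v : ℤ, ∀ τ z₁ z₂ : ℂ, UHP τ →
      φ τ (z₁ + ((p : ℂ) + (q : ℂ) * Complex.I) * τ + ((u : ℂ) + (v : ℂ) * Complex.I))
          (z₂ + ((p : ℂ) - (q : ℂ) * Complex.I) * τ + ((u : ℂ) - (v : ℂ) * Complex.I))
      = eC (-(m : ℂ) * (((p : ℂ) ^ 2 + (q : ℂ) ^ 2) * τ
          + ((p : ℂ) - (q : ℂ) * Complex.I) * z₁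
          + ((p : ℂ) + (q : ℂ) * Complex.I) * z₂)) * φ τ z₁ z₂
  cusp : ∀ M : Matrix.SpecialLinearGroup (Fin 2) ℤ,
      ∃ c : ℚ → ℤ → ℤ → ℂ,
        (∀ (n : ℚ) (a b : ℤ),
          ¬ (0 ≤ n ∧ ((a : ℚ) ^ 2 + (b : ℚ) ^ 2) ≤ 4 * n * m) → c n a b = 0) ∧
        ∀ τ z₁ z₂ : ℂ, UHP τ →
          HasSum (fun p : ℚ × ℤ × ℤ => c p.1 p.2.1 p.2.2 *
            eC ((p.1 : ℂ) * τ + (((p.2.1 : ℂ) + (p.2.2 : ℂ) * Complex.I) / 2) * z₁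
              + (((p.2.1 : ℂ) - (p.2.2 : ℂ) * Complex.I) / 2) * z₂))
            (slashHJF k m φ M τ z₁ z₂)

/-- Theta constant `x`. -/
def thConstX (τ : ℂ) : ℂ := ∑' n : ℤ, eC ((n : ℂ) ^ 2 * τ / 2)

/-- Theta constant `y`. -/
def thConstY (τ : ℂ) : ℂ := ∑' n : ℤ, (-1 : ℂ) ^ n * eC ((n : ℂ) ^ 2 * τ / 2)

/-- Theta constant `z`. -/
def thConstZ (τ : ℂ) : ℂ := ∑' n : ℤ, eC (((n : ℂ) + 1 / 2) ^ 2 * τ / 2)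

lemma eC_add' (x y : ℂ) : eC (x + y) = eC x * eC y := by
  unfold eC; rw [mul_add, Complex.exp_add]

lemma eC_ne' (x : ℂ) : eC x ≠ 0 := Complex.exp_ne_zero _

lemma eC_int' (n : ℤ) : eC n = 1 := by
  unfold eC
  rw [Complex.exp_eq_one_iff]
  exact ⟨n, by ring⟩

lemma eC_cont' : Continuous eC := by unfold eC; fun_prop

lemma norm_eC_real' (x : ℝ) : ‖eC x‖ = 1 := by
  unfold eC
  rw [Complex.norm_exp]
  simp

lemma theta_summable' (μ : ℤ) (τ z : ℂ) (hτ : UHP τ) :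
    Summable (fun g : ℤ => ‖eC (((μ : ℂ) + 2 * (2 : ℕ) * g) ^ 2 / (4 * (2 : ℕ)) * τ
      + ((μ : ℂ) + 2 * (2 : ℕ) * g) * z)‖) := by
  apply Summable.norm
  have h4 : 0 < (4 * τ).im := by
    have : 0 < τ.im := hτ
    simpa using this
  have := ((summable_jacobiTheta₂_term_iff (4 * z + μ * τ) (4 * τ)).2 h4).mul_left
    (eC ((μ : ℂ) ^ 2 / 8 * τ + μ * z))
  refine this.congr fun g => ?_
  unfold eC jacobiTheta₂_term
  rw [← Complex.exp_add]
  congr 1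
  push_cast
  ring

lemma thetaH_eq' (a b : ℤ) (τ z : ℂ) (hτ : UHP τ) :
    thetaH 2 a b τ z z = thetaJ 2 a τ z * thetaJ 2 b τ 0 := by
  unfold thetaH thetaJ
  rw [tsum_mul_tsum_of_summable_norm (theta_summable' a τ z hτ) (theta_summable' b τ 0 hτ)]
  refine tsum_congr fun g => ?_
  rw [← eC_add']
  congr 1
  push_cast
  ring

lemma thetaJ_neg' (μ : ℤ) (τ z : ℂ) : thetaJ 2 μ τ (-z) = thetaJ 2 (-μ) τ z := by
  unfold thetaJ
  rw [← (Equiv.neg ℤ).tsum_eq]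
  refine tsum_congr fun g => ?_
  congr 1
  simp only [Equiv.neg_apply]
  push_cast
  ring

lemma norm_bd' (μ g : ℤ) (τ : ℂ) (x : ℝ) :
    ‖eC (((μ : ℂ) + 2 * (2 : ℕ) * g) ^ 2 / (4 * (2 : ℕ)) * τ
      + ((μ : ℂ) + 2 * (2 : ℕ) * g) * x)‖ =
    ‖eC (((μ : ℂ) + 2 * (2 : ℕ) * g) ^ 2 / (4 * (2 : ℕ)) * τ
      + ((μ : ℂ) + 2 * (2 : ℕ) * g) * 0)‖ := by
  rw [eC_add', eC_add', norm_mul, norm_mul]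
  congr 1
  have h1 := norm_eC_real' (((μ : ℝ) + 2 * (2 : ℕ) * g) * x)
  have h2 := norm_eC_real' 0
  push_cast at h1 h2 ⊢
  rw [h1, mul_zero, h2]

lemma thetaJ_cont' (μ : ℤ) (τ : ℂ) (hτ : UHP τ) :
    Continuous (fun x : ℝ => thetaJ 2 μ τ x) := by
  unfold thetaJ
  refine continuous_tsum (fun g => eC_cont'.comp (by fun_prop)) (theta_summable' μ τ 0 hτ)
    fun g x => (norm_bd' μ g τ x).le

lemma int_eC' (n : ℤ) : ∫ x in (0:ℝ)..1, eC (n * x) = if n = 0 then 1 else 0 := by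
  split_ifs with hn
  · subst hn
    simp [eC]
  · have hc : 2 * (Real.pi : ℂ) * Complex.I * n ≠ 0 := by
      simp [Real.pi_ne_zero, hn]
    have := integral_exp_mul_complex (a := 0) (b := 1) hc
    have e : ∀ x : ℝ, eC (n * x) = Complex.exp (2 * (Real.pi : ℂ) * Complex.I * n * x) := by
      intro x; unfold eC; congr 1; ring
    simp_rw [e]
    rw [this]
    have h1 := eC_int' n
    unfold eC at h1
    simp [h1]

lemma int_thetaJ' (μ ν : ℤ) (τ : ℂ) (hτ : UHP τ) :
    ∫ x in (0:ℝ)..1, eC (-ν * x) * thetaJ 2 μ τ x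
      = if (4 : ℤ) ∣ ν - μ then eC ((ν : ℂ) ^ 2 / 8 * τ) else 0 := by
  have key : HasSum (fun g : ℤ => ∫ x in (0:ℝ)..1, eC (-ν * x) *
      eC (((μ : ℂ) + 2 * (2 : ℕ) * g) ^ 2 / (4 * (2 : ℕ)) * τ
      + ((μ : ℂ) + 2 * (2 : ℕ) * g) * x)) (∫ x in (0:ℝ)..1, eC (-ν * x) * thetaJ 2 μ τ x) := by
    refine intervalIntegral.hasSum_integral_of_dominated_convergence
      (fun g _ => ‖eC (((μ : ℂ) + 2 * (2 : ℕ) * g) ^ 2 / (4 * (2 : ℕ)) * τ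
      + ((μ : ℂ) + 2 * (2 : ℕ) * g) * 0)‖) ?_ ?_ ?_ ?_ ?_
    · intro g
      refine Continuous.aestronglyMeasurable ?_
      exact (eC_cont'.comp (by fun_prop)).mul (eC_cont'.comp (by fun_prop))
    · intro g
      refine Filter.Eventually.of_forall fun x _ => ?_
      rw [norm_mul, norm_bd']
      have h1 := norm_eC_real' (-(ν : ℝ) * x)
      push_cast at h1
      rw [h1, one_mul]
    · exact Filter.Eventually.of_forall fun x _ => theta_summable' μ τ 0 hτ
    · exact intervalIntegrable_const
    · refine Filter.Eventually.of_forall fun x _ => ?_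
      exact ((theta_summable' μ τ x hτ).of_norm.hasSum).mul_left _
  have e : ∀ g : ℤ, (∫ x in (0:ℝ)..1, eC (-ν * x) *
      eC (((μ : ℂ) + 2 * (2 : ℕ) * g) ^ 2 / (4 * (2 : ℕ)) * τ
      + ((μ : ℂ) + 2 * (2 : ℕ) * g) * x)) =
      if ν - μ = 4 * g then eC ((ν : ℂ) ^ 2 / 8 * τ) else 0 := by
    intro g
    have e1 : ∀ x : ℝ, eC (-ν * x) *
      eC (((μ : ℂ) + 2 * (2 : ℕ) * g) ^ 2 / (4 * (2 : ℕ)) * τ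
      + ((μ : ℂ) + 2 * (2 : ℕ) * g) * x) =
      eC (((μ : ℂ) + 4 * g) ^ 2 / 8 * τ) * eC ((μ + 4 * g - ν : ℤ) * x) := by
      intro x
      rw [← eC_add', ← eC_add']
      congr 1
      push_cast
      ring
    simp_rw [e1]
    rw [intervalIntegral.integral_const_mul, int_eC']
    by_cases hg : ν - μ = 4 * g
    · have hν : ν = μ + 4 * g := by omega
      rw [if_pos hg, if_pos (by omega), hν]
      push_cast
      ring
    · rw [if_neg hg, if_neg (by omega), mul_zero]
  simp_rw [e] at key
  split_ifs with hd
  · obtain ⟨g0, hg0⟩ := hd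
    have := hasSum_ite_eq g0 (eC ((ν : ℂ) ^ 2 / 8 * τ))
    refine key.unique ?_
    convert this using 2 with g
    congr 1
    apply propext
    constructor <;> intro h <;> omega
  · refine key.unique ?_
    have : (fun g : ℤ => if ν - μ = 4 * g then eC ((ν : ℂ) ^ 2 / 8 * τ) else 0)
        = fun _ => 0 := by
      funext g
      rw [if_neg]
      intro h
      exact hd ⟨g, h⟩
    rw [this]
    exact hasSum_zero

lemma int_sum' (C : ℕ → ℂ) (s : ℕ → ℤ) (ν : ℤ) (τ : ℂ) (hτ : UHP τ) :
    ∫ x in (0:ℝ)..1, eC (-ν * x) * ∑ μ ∈ Finset.range 4, C μ * thetaJ 2 (s μ) τ x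
      = (∑ μ ∈ Finset.range 4, C μ * if (4 : ℤ) ∣ ν - s μ then 1 else 0)
        * eC ((ν : ℂ) ^ 2 / 8 * τ) := by
  simp_rw [Finset.mul_sum]
  rw [intervalIntegral.integral_finset_sum, Finset.sum_mul]
  · refine Finset.sum_congr rfl fun μ _ => ?_
    have : ∀ x : ℝ, eC (-ν * x) * (C μ * thetaJ 2 (s μ) τ x)
      = C μ * (eC (-ν * x) * thetaJ 2 (s μ) τ x) := fun x => by ring
    simp_rw [this]
    rw [intervalIntegral.integral_const_mul, int_thetaJ' _ _ _ hτ]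
    split_ifs <;> ring
  · intro μ _
    apply Continuous.intervalIntegrable
    exact (eC_cont'.comp (by fun_prop)).mul (continuous_const.mul (thetaJ_cont' _ _ hτ))

lemma mod_h' (f : ℤ → ℂ) (hf : ∀ a, f (a + 4) = f a) (a : ℤ) : f a = f (a % 4) := by
  have hp : Function.Periodic f 4 := hf
  have h1 := hp.int_mul (a / 4) (a % 4)
  rw [← h1]
  congr 1
  have := Int.emod_add_mul_ediv a 4
  simp only [Int.cast_id]
  omega

/-- theta decomposition of `π₁ φ` for `φ ∈ J_{k,2}(O_K)` with theta
components `h_{a,b}`: `(π₁φ)(τ,z) = Σ_{μ mod 4} H_μ(τ) θ_{2,μ}(τ,z)` with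
`H_μ = Σ_b h_{μ,b} a_b`, `H_μ = (-1)^k H_{-μ}`, and
`θ^H_{2,(a+ib)/2}(τ,z,z) = θ_{2,a}(τ,z) a_b`. -/
theorem stmt8 (k : ℕ) (hk : 0 < k) (φ : ℂ → ℂ → ℂ → ℂ) (h : ℤ → ℤ → ℂ → ℂ)
    (hφ : IsHJF k 2 φ) (hdec : HasThetaDecomp 2 φ h) :
    (∀ (a b : ℤ) (τ z : ℂ), UHP τ →
      thetaH 2 a b τ z z = thetaJ 2 a τ z * thetaJ 2 b τ 0) ∧
    (∀ τ z : ℂ, UHP τ →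
      φ τ z z = ∑ μ ∈ Finset.range 4,
        (∑ b ∈ Finset.range 4, h (μ : ℤ) (b : ℤ) τ * thetaJ 2 (b : ℤ) τ 0)
          * thetaJ 2 (μ : ℤ) τ z) ∧
    (∀ (μ : ℤ) (τ : ℂ), UHP τ →
      (∑ b ∈ Finset.range 4, h μ (b : ℤ) τ * thetaJ 2 (b : ℤ) τ 0)
        = (-1 : ℂ) ^ k *
          ∑ b ∈ Finset.range 4, h (-μ) (b : ℤ) τ * thetaJ 2 (b : ℤ) τ 0) := by
  have hB : ∀ τ z : ℂ, UHP τ →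
      φ τ z z = ∑ μ ∈ Finset.range 4,
        (∑ b ∈ Finset.range 4, h (μ : ℤ) (b : ℤ) τ * thetaJ 2 (b : ℤ) τ 0)
          * thetaJ 2 (μ : ℤ) τ z := by
    intro τ z hτ
    rw [hdec.2 τ z z hτ]
    refine Finset.sum_congr rfl fun a _ => ?_
    rw [Finset.sum_mul]
    refine Finset.sum_congr rfl fun b _ => ?_
    rw [thetaH_eq' _ _ _ _ hτ]
    ring
  refine ⟨fun a b τ z hτ => thetaH_eq' a b τ z hτ, hB, ?_⟩
  intro μ τ hτ
  set H : ℤ → ℂ := fun μ => ∑ b ∈ Finset.range 4, h μ (b : ℤ) τ * thetaJ 2 (b : ℤ) τ 0 with hH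
  change H μ = (-1 : ℂ) ^ k * H (-μ)
  have hper : ∀ a, H (a + 4) = H a := by
    intro a
    simp only [hH]
    refine Finset.sum_congr rfl fun b _ => ?_
    have := (hdec.1 a b τ).1
    norm_num at this
    rw [this]
  have hsym : ∀ z : ℂ, φ τ (-z) (-z) = (-1 : ℂ) ^ k * φ τ z z := by
    intro z
    have := hφ.transf (-1) (by simp) 1 τ z z hτ
    simpa [Ma, Mb, Mc, Md, eC] using this
  have hfun : ∀ z : ℂ, ∑ μ ∈ Finset.range 4, H μ * thetaJ 2 (-(μ : ℤ)) τ z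
      = (-1 : ℂ) ^ k * ∑ μ ∈ Finset.range 4, H μ * thetaJ 2 (μ : ℤ) τ z := by
    intro z
    have h1 := hsym z
    rw [hB τ _ hτ, hB τ _ hτ] at h1
    simp_rw [thetaJ_neg'] at h1
    exact h1
  have hint : ∀ ν : ℤ,
      (∑ μ ∈ Finset.range 4, H μ * if (4 : ℤ) ∣ ν - (-(μ : ℤ)) then 1 else 0)
      = (-1 : ℂ) ^ k * ∑ μ ∈ Finset.range 4, H μ * if (4 : ℤ) ∣ ν - (μ : ℤ) then 1 else 0 := by
    intro ν
    have h1 := int_sum' (fun μ => H μ) (fun μ => -(μ : ℤ)) ν τ hτ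
    have h2 := int_sum' (fun μ => H μ) (fun μ => (μ : ℤ)) ν τ hτ
    simp_rw [hfun, mul_left_comm _ ((-1 : ℂ) ^ k)] at h1
    rw [intervalIntegral.integral_const_mul, h2, ← mul_assoc] at h1
    exact (mul_right_cancel₀ (eC_ne' _) h1).symm
  have k0 := hint 0
  have k1 := hint 1
  have k2 := hint 2
  have k3 := hint 3
  norm_num [Finset.sum_range_succ] at k0 k1 k2 k3
  rw [mod_h' H hper μ, mod_h' H hper (-μ)]
  have hm : μ % 4 = 0 ∨ μ % 4 = 1 ∨ μ % 4 = 2 ∨ μ % 4 = 3 := by omega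
  rcases hm with hm | hm | hm | hm
  · rw [hm, show (-μ) % 4 = 0 by omega]; exact k0
  · rw [hm, show (-μ) % 4 = 3 by omega]; exact k3
  · rw [hm, show (-μ) % 4 = 2 by omega]; exact k2
  · rw [hm, show (-μ) % 4 = 1 by omega]; exact k1
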